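/- arXiv:2605.04303 — 3 statements merged into one kernel-verified Lean document; each statement's English description precedes it below -/
import Mathlib

section
/- Assume A is finite and free as a k-module. Let tr, tr′ : A → k be k-linear homogeneous trace maps of parities ε, ε′ ∈ ZMod 2 respectively (i.e. tr vanishes on 𝒜 (ε + 1) and tr′ vanishes on 𝒜 (ε′ + 1)), and assume both trace pairings are perfect, in the sense that for each τ ∈ {tr, tr′} the k-linear map A → Module.Dual k A, y ↦ (x ↦ τ (x * y)), is bijective. Then there exists an element u ∈ A such that u is a unit of A, u is homogeneous of parity ε + ε′ (u ∈ 𝒜 (ε + ε′)), and tr′ (a) = tr (a * u) for all a ∈ A. -/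
/-- In a `ZMod 2`-graded module every element is the sum of a component of parity `i`
and one of parity `i + 1`. -/
theorem exists_add_of_zmod_two_decomposition {k M : Type*} [CommRing k] [AddCommGroup M]
    [Module k M] (𝒜 : ZMod 2 → Submodule k M) [DirectSum.Decomposition 𝒜] (i : ZMod 2) (x : M) :
    ∃ y ∈ 𝒜 i, ∃ z ∈ 𝒜 (i + 1), x = y + z := by
  induction x using DirectSum.Decomposition.inductionOn 𝒜 with
  | zero => exact ⟨0, zero_mem _, 0, zero_mem _, (add_zero 0).symm⟩
  | @homogeneous j m =>
    have hj : j = i ∨ j = i + 1 := (by decide : ∀ i j : ZMod 2, j = i ∨ j = i + 1) i j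
    rcases hj with rfl | rfl
    · exact ⟨m, m.2, 0, zero_mem _, (add_zero _).symm⟩
    · exact ⟨0, zero_mem _, m, m.2, (zero_add _).symm⟩
  | add m n hm hn =>
    obtain ⟨y, hy, z, hz, rfl⟩ := hm
    obtain ⟨y', hy', z', hz', rfl⟩ := hn
    exact ⟨y + y', add_mem hy hy', z + z', add_mem hz hz', add_add_add_comm ..⟩

/-- An element representing a homogeneous functional with respect to a homogeneous
nondegenerate trace is homogeneous. -/
theorem mem_of_homogeneous_trace_eq {k A : Type*} [CommRing k] [Ring A] [Algebra k A]
    (𝒜 : ZMod 2 → Submodule k A) [GradedAlgebra 𝒜] {tr tr' : A →ₗ[k] k} {ε ε' : ZMod 2}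
    (htr : ∀ a ∈ 𝒜 (ε + 1), tr a = 0) (htr' : ∀ a ∈ 𝒜 (ε' + 1), tr' a = 0)
    (hnondeg : ∀ w : A, (∀ a, tr (a * w) = 0) → w = 0)
    {u : A} (hu : ∀ a, tr' a = tr (a * u)) : u ∈ 𝒜 (ε + ε') := by
  obtain ⟨y, hy, w, hw, rfl⟩ := exists_add_of_zmod_two_decomposition 𝒜 (ε + ε') u
  suffices h : w = 0 by simpa [h] using hy
  refine hnondeg w fun a => ?_
  obtain ⟨b, hb, c, hc, rfl⟩ := exists_add_of_zmod_two_decomposition 𝒜 ε' a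
  have hbw : tr (b * w) = 0 := by
    refine htr _ ?_
    have h := SetLike.mul_mem_graded hb hw
    rwa [(by decide : ∀ ε ε' : ZMod 2, ε' + (ε + ε' + 1) = ε + 1) ε ε'] at h
  have hcy : tr (c * y) = 0 := by
    refine htr _ ?_
    have h := SetLike.mul_mem_graded hc hy
    rwa [(by decide : ∀ ε ε' : ZMod 2, ε' + 1 + (ε + ε') = ε + 1) ε ε'] at h
  have hcw : tr (c * w) = 0 := by
    simpa [mul_add, hcy, htr' c hc] using (hu c).symm
  rw [add_mul, map_add, hbw, hcw, add_zero]


/-- **Two Frobenius trace maps differ by a homogeneous unit (Lemma 5.8, first part).**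
If `A` is finite free over `k` and `tr`, `tr′` are homogeneous trace maps of
parities `ε`, `ε′` with perfect trace pairings, then there exists a
homogeneous unit `u ∈ 𝒜 (ε + ε′)` with `tr′ (a) = tr (a * u)` for all `a`. -/
theorem traces_differ_by_unit
    (k : Type*) [CommRing k] (A : Type*) [Ring A] [Algebra k A]
    [Module.Finite k A] [Module.Free k A]
    (𝒜 : ZMod 2 → Submodule k A) [GradedAlgebra 𝒜]
    (tr tr' : A →ₗ[k] k) (ε ε' : ZMod 2)
    (htr : ∀ a ∈ 𝒜 (ε + 1), tr a = 0)
    (htr' : ∀ a ∈ 𝒜 (ε' + 1), tr' a = 0)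
    (hperf : Function.Bijective fun y : A =>
      (tr ∘ₗ LinearMap.mulRight k y : Module.Dual k A))
    (hperf' : Function.Bijective fun y : A =>
      (tr' ∘ₗ LinearMap.mulRight k y : Module.Dual k A)) :
    ∃ u : A, IsUnit u ∧ u ∈ 𝒜 (ε + ε') ∧ ∀ a : A, tr' a = tr (a * u) := by
  have key : ∀ {t : A →ₗ[k] k}, (Function.Injective fun y : A =>
      (t ∘ₗ LinearMap.mulRight k y : Module.Dual k A)) →
      ∀ {x y : A}, (∀ a, t (a * x) = t (a * y)) → x = y :=
    fun ht _ _ h => ht (LinearMap.ext h)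
  obtain ⟨u, hu⟩ := hperf.2 tr'
  obtain ⟨v, hv⟩ := hperf'.2 tr
  replace hu : ∀ a, tr' a = tr (a * u) := fun a => (LinearMap.congr_fun hu a).symm
  replace hv : ∀ a, tr a = tr' (a * v) := fun a => (LinearMap.congr_fun hv a).symm
  have hvu : v * u = 1 := key hperf.1 fun a => by rw [← mul_assoc, ← hu, ← hv, mul_one]
  have huv : u * v = 1 := key hperf'.1 fun a => by rw [← mul_assoc, ← hv, ← hu, mul_one]
  refine ⟨u, ⟨⟨u, v, huv, hvu⟩, rfl⟩, ?_, hu⟩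
  exact mem_of_homogeneous_trace_eq 𝒜 htr htr'
    (fun w hw => key hperf.1 fun a => by rw [hw, mul_zero, map_zero]) hu
end

section
/- Let tr, tr′ : A → k be k-linear maps, and let ψ, ψ′ : A → A be k-algebra automorphisms satisfying the Nakayama properties tr (a * c) = (−1)^{i·j} · tr (c * ψ a) and tr′ (a * c) = (−1)^{i·j} · tr′ (c * ψ′ a) for all i, j ∈ ZMod 2, a ∈ 𝒜 i, c ∈ 𝒜 j. Suppose u is a unit of A, homogeneous of parity μ ∈ ZMod 2 (u ∈ 𝒜 μ), such that tr′ (a) = tr (a * u) for all a ∈ A, and suppose the k-linear map A → Module.Dual k A, y ↦ (x ↦ tr′ (x * y)), is injective. Then for every i ∈ ZMod 2 and every a ∈ 𝒜 i one has ψ′ (a) = (−1)^{μ·i} · u * ψ (a) * u⁻¹. -/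
/-- **Relation between Nakayama automorphisms (Lemma 5.8, second part).**
If `tr′ (a) = tr (a * u)` for a homogeneous unit `u` of parity `μ`, and
`ψ`, `ψ′` are Nakayama automorphisms for `tr`, `tr′` respectively, then
`ψ′ (a) = (−1)^{μ·|a|} u * ψ (a) * u⁻¹` for homogeneous `a`. -/
theorem nakayama_of_twisted_trace
    (k : Type*) [CommRing k] (A : Type*) [Ring A] [Algebra k A]
    (𝒜 : ZMod 2 → Submodule k A) [GradedAlgebra 𝒜]
    (tr tr' : A →ₗ[k] k)
    (ψ ψ' : A ≃ₐ[k] A)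
    (hψ : ∀ (i j : ZMod 2), ∀ a ∈ 𝒜 i, ∀ c ∈ 𝒜 j,
      tr (a * c) = (if i = 1 ∧ j = 1 then (-1 : k) else 1) * tr (c * ψ a))
    (hψ' : ∀ (i j : ZMod 2), ∀ a ∈ 𝒜 i, ∀ c ∈ 𝒜 j,
      tr' (a * c) = (if i = 1 ∧ j = 1 then (-1 : k) else 1) * tr' (c * ψ' a))
    (u : Aˣ) (μ : ZMod 2) (hu : (u : A) ∈ 𝒜 μ)
    (htr' : ∀ a : A, tr' a = tr (a * u))
    (hinj : Function.Injective fun y : A =>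
      (tr' ∘ₗ LinearMap.mulRight k y : Module.Dual k A)) :
    ∀ (i : ZMod 2), ∀ a ∈ 𝒜 i,
      ψ' a = (if μ = 1 ∧ i = 1 then (-1 : k) else 1) •
        ((u : A) * ψ a * ((u⁻¹ : Aˣ) : A)) := by
  intro i a ha
  refine hinj (LinearMap.ext fun c => ?_)
  induction c using DirectSum.Decomposition.inductionOn 𝒜 with
  | zero => simp
  | add x y hx hy => rw [map_add, map_add, hx, hy]
  | @homogeneous j c =>
    have hψ'c := hψ' i j a ha c c.2
    have hψcu := hψ i (j + μ) a ha (c * u) (SetLike.mul_mem_graded c.2 hu)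
    have hconj : tr' (c * (u * ψ a * (u⁻¹ : Aˣ))) = tr (c * u * ψ a) := by
      rw [htr']
      simp only [mul_assoc, Units.inv_mul, mul_one]
    rw [htr' (a * c), mul_assoc, hψcu] at hψ'c
    simp only [LinearMap.comp_apply, LinearMap.mulRight_apply, mul_smul_comm, map_smul,
      smul_eq_mul, hconj]
    generalize tr (c * u * ψ a) = s at hψ'c ⊢
    generalize tr' (c * ψ' a) = t at hψ'c ⊢
    clear * - hψ'c
    have parity : ∀ x : ZMod 2, x = 0 ∨ x = 1 := by decide
    have one_add_one : (1 : ZMod 2) + 1 = 0 := by decide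
    rcases parity i with rfl | rfl <;> rcases parity j with rfl | rfl <;>
      rcases parity μ with rfl | rfl <;> simp_all
end

section
/- Let k be a commutative ring and R an associative unital k-algebra that is flat as a k-module; let n be a positive natural number and i an index in Fin n. Suppose f ∈ R is central (f * g = g * f for all g ∈ R) and regular (both the left multiplication map g ↦ f * g and the right multiplication map g ↦ g * f are injective on R). Let f_i denote the element of the n-fold tensor power algebra ⨂[k]_{j : Fin n} R given by the pure tensor with f in the i-th factor and 1 in every other factor. Then f_i is central in ⨂[k]_{j : Fin n} R and f_i is regular in ⨂[k]_{j : Fin n} R (both left and right multiplication by f_i are injective). -/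
open scoped TensorProduct

namespace PiTensorProduct

/-- A finite tensor product of flat modules is flat. -/
theorem flat_of_finite {k : Type*} [CommRing k] {ι : Type*} [Finite ι] (M : ι → Type*)
    [∀ i, AddCommGroup (M i)] [∀ i, Module k (M i)] [∀ i, Module.Flat k (M i)] :
    Module.Flat k (⨂[k] i, M i) := by
  classical
  induction h : Nat.card ι generalizing ι with
  | zero =>
    have : IsEmpty ι := (Nat.card_eq_zero.mp h).resolve_right (not_infinite_iff_finite.mpr ‹_›)
    exact Module.Flat.of_linearEquiv (isEmptyEquiv (R := k) (s := M) ι)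
  | succ m ih =>
    have : Nonempty ι := (Nat.card_pos_iff.mp (by omega)).1
    obtain ⟨i⟩ := this
    have hcard : Nat.card ({i}ᶜ : Set ι) = m := by
      have := Set.ncard_add_ncard_compl ({i} : Set ι)
      rw [Set.ncard_singleton, h] at this
      rw [Nat.card_coe_set_eq]
      omega
    have := ih (fun j : ({i}ᶜ : Set ι) ↦ M j) hcard
    exact Module.Flat.of_linearEquiv (equivPiTensorComplSingletonTensor k M i)

/-- Multiplication by a pure tensor concentrated in one factor is injective as soon as
multiplication by its entry is, provided that the factors are flat. -/
theorem tprod_update_mul_injective {k : Type*} [CommRing k] {ι : Type*} [Finite ι]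
    [DecidableEq ι] (A : ι → Type*) [∀ i, Ring (A i)] [∀ i, Algebra k (A i)]
    [∀ i, Module.Flat k (A i)] (i : ι) {f : A i}
    (hf : Function.Injective fun g : A i ↦ f * g) :
    Function.Injective fun g : ⨂[k] j, A j ↦
      tprod k (Function.update (fun j ↦ (1 : A j)) i f) * g := by
  let e := equivPiTensorComplSingletonTensor k A i
  have := flat_of_finite (k := k) (fun j : ({i}ᶜ : Set ι) ↦ A j)
  have hinj : Function.Injective
      (LinearMap.lTensor (⨂[k] j : ({i}ᶜ : Set ι), A j) (LinearMap.mulLeft k f)) :=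
    Module.Flat.lTensor_preserves_injective_linearMap _ hf
  have hconj : e.toLinearMap ∘ₗ
      LinearMap.mulLeft k (tprod k (Function.update (fun j ↦ (1 : A j)) i f)) =
      LinearMap.lTensor _ (LinearMap.mulLeft k f) ∘ₗ e.toLinearMap := by
    ext x
    simp only [e, LinearMap.compMultilinearMap_apply, LinearMap.comp_apply, LinearEquiv.coe_coe,
      LinearMap.mulLeft_apply, tprod_mul_tprod, equivPiTensorComplSingletonTensor_tprod,
      LinearMap.lTensor_tmul, Pi.mul_apply, Function.update_self]
    congr 2
    funext j
    have hj : (j : ι) ≠ i := j.2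
    simp [hj]
  have : Function.Injective (e.toLinearMap ∘ₗ
      LinearMap.mulLeft k (tprod k (Function.update (fun j ↦ (1 : A j)) i f))) := by
    rw [hconj]
    exact hinj.comp e.injective
  exact Function.Injective.of_comp (f := e) this

/-- A pure tensor concentrated in one factor is central if its entry is. -/
theorem tprod_update_mul_comm {k : Type*} [CommRing k] {ι : Type*} [DecidableEq ι]
    (A : ι → Type*) [∀ i, Ring (A i)] [∀ i, Algebra k (A i)] (i : ι) {f : A i}
    (hf : ∀ g : A i, f * g = g * f) (g : ⨂[k] j, A j) :
    tprod k (Function.update (fun j ↦ (1 : A j)) i f) * g =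
      g * tprod k (Function.update (fun j ↦ (1 : A j)) i f) := by
  induction g using PiTensorProduct.induction_on with
  | smul_tprod r x =>
    rw [mul_smul_comm, smul_mul_assoc, tprod_mul_tprod, tprod_mul_tprod]
    congr 2
    funext j
    obtain rfl | hj := eq_or_ne j i
    · simpa using hf (x j)
    · simp [hj]
  | add x y hx hy => rw [mul_add, add_mul, hx, hy]

end PiTensorProduct

/-- **Lemma 5.3 (ungraded form): `f_i` is central and regular in the tensor
power algebra.**
Let `R` be a `k`-algebra that is flat as a `k`-module, and let `f ∈ R` be
central and regular. Then the pure tensor `f_i` with `f` in the `i`-th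
factor and `1` elsewhere is central and regular in `⨂[k]_{j : Fin n} R`. -/
theorem tensor_power_central_regular
    (k : Type*) [CommRing k] (R : Type*) [Ring R] [Algebra k R]
    [Module.Flat k R]
    (n : ℕ) (hn : 0 < n) (i : Fin n)
    (f : R)
    (hcentral : ∀ g : R, f * g = g * f)
    (hregL : Function.Injective fun g : R => f * g)
    (hregR : Function.Injective fun g : R => g * f) :
    (∀ g : ⨂[k] _ : Fin n, R,
        PiTensorProduct.tprod k (Function.update (fun _ : Fin n => (1 : R)) i f) * g
          = g * PiTensorProduct.tprod k (Function.update (fun _ : Fin n => (1 : R)) i f)) ∧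
      Function.Injective (fun g : ⨂[k] _ : Fin n, R =>
        PiTensorProduct.tprod k (Function.update (fun _ : Fin n => (1 : R)) i f) * g) ∧
      Function.Injective (fun g : ⨂[k] _ : Fin n, R =>
        g * PiTensorProduct.tprod k (Function.update (fun _ : Fin n => (1 : R)) i f)) := by
  have hcomm := PiTensorProduct.tprod_update_mul_comm (k := k) (fun _ : Fin n => R) i hcentral
  have hinj := PiTensorProduct.tprod_update_mul_injective (k := k) (fun _ : Fin n => R) i hregL
  exact ⟨hcomm, hinj, by simpa only [hcomm] using hinj⟩
end
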